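/- arXiv:1501.01696 — 7 statements merged into one kernel-verified Lean document; each statement's English description precedes it below -/
import Mathlib

section
/- Let R be a finite set of records, b : R → K a blocking key with fibers (blocks) B_1, …, B_u listed in a fixed order, w ≥ 2 an integer, and f a local scoring heuristic, i.e., a symmetric nonnegative real-valued function on pairs of distinct records with f(r, s) = 0 whenever b(r) ≠ b(s). Then for any lists L_1, …, L_u, where L_i enumerates B_i without repetition, the w-score of the concatenated list L_1 ⌢ L_2 ⌢ ⋯ ⌢ L_u equals the sum over i of the w-score of L_i. -/
open Finset in
/-- The w-score of a list `l` under scoring function `f` with window size `w`: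
`Σ_{i < j, j − i ≤ w − 1} f(l_i, l_j)`. -/
noncomputable def wScore {α : Type*} (f : α → α → ℝ) (w : ℕ) (l : List α) : ℝ :=
  ∑ i : Fin l.length, ∑ j : Fin l.length,
    if (i : ℕ) < (j : ℕ) ∧ (j : ℕ) - (i : ℕ) ≤ w - 1 then f (l.get i) (l.get j) else 0

/-- The w-score is additive over a concatenation whose cross scores vanish. -/
theorem wScore_append_of_cross_eq_zero {α : Type*} (f : α → α → ℝ) (w : ℕ) (l₁ l₂ : List α)
    (h : ∀ r ∈ l₁, ∀ s ∈ l₂, f r s = 0) :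
    wScore f w (l₁ ++ l₂) = wScore f w l₁ + wScore f w l₂ := by
  have sum_append (g : Fin (l₁ ++ l₂).length → ℝ) :
      ∑ i, g i = ∑ i : Fin (l₁.length + l₂.length), g (Fin.cast List.length_append.symm i) :=
    (Equiv.sum_comp (finCongr List.length_append.symm) g).symm
  unfold wScore
  simp only [sum_append, Fin.sum_univ_add, Finset.sum_add_distrib]
  have hcross : ∀ (i : Fin l₁.length) (j : Fin l₂.length), f l₁[i] l₂[j] = 0 :=
    fun i j => h _ (List.getElem_mem _) _ (List.getElem_mem _)
  have hback : ∀ (i : Fin l₂.length) (j : Fin l₁.length),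
      ¬ (l₁.length + (i : ℕ) < j) := fun i j => by omega
  simp [hback, List.getElem_append_right, Nat.add_sub_add_left]
  refine Finset.sum_eq_zero fun i _ => Finset.sum_eq_zero fun j _ => ?_
  split_ifs
  · exact hcross i j
  · rfl

/-- The w-score of a concatenation of lists with pairwise vanishing cross scores is the sum of
their w-scores. -/
theorem wScore_flatten_of_pairwise {α : Type*} (f : α → α → ℝ) (w : ℕ) (Ls : List (List α))
    (h : Ls.Pairwise fun l₁ l₂ => ∀ r ∈ l₁, ∀ s ∈ l₂, f r s = 0) :
    wScore f w Ls.flatten = (Ls.map (wScore f w)).sum := by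
  induction Ls with
  | nil => simp [wScore]
  | cons l Ls ih =>
    rw [List.pairwise_cons] at h
    rw [List.flatten_cons, wScore_append_of_cross_eq_zero, ih h.2, List.map_cons, List.sum_cons]
    intro r hr s hs
    obtain ⟨l', hl', hs⟩ := List.mem_flatten.1 hs
    exact h.1 l' hl' r hr s hs

/-- For a local scoring heuristic `f` (symmetric, nonnegative, vanishing on
pairs with different blocking key values), the w-score of the concatenation of lists
`L_1 ⌢ ⋯ ⌢ L_u`, where `L_i` enumerates the block (fiber) of key value `y i` without
repetition, equals the sum of the w-scores of the `L_i`. -/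
theorem wScore_concat_eq_sum_of_local {α K : Type*} (R : Finset α) (b : α → K)
    (u : ℕ) (y : Fin u → K) (hy : Function.Injective y)
    (w : ℕ) (hw : 2 ≤ w) (f : α → α → ℝ)
    (hsymm : ∀ r s, f r s = f s r) (hnonneg : ∀ r s, 0 ≤ f r s)
    (hlocal : ∀ r s, b r ≠ b s → f r s = 0)
    (L : Fin u → List α)
    (hnodup : ∀ i, (L i).Nodup)
    (henum : ∀ i x, x ∈ L i ↔ (x ∈ R ∧ b x = y i)) :
    wScore f w (List.ofFn L).flatten = ∑ i, wScore f w (L i) := by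
  rw [wScore_flatten_of_pairwise, List.map_ofFn, List.sum_ofFn]
  · rfl
  · rw [List.pairwise_ofFn]
    intro i j hij r hr s hs
    apply hlocal
    rw [((henum i r).1 hr).2, ((henum j s).1 hs).2]
    exact hy.ne hij.ne
end

section
/- Let R be a finite set of records, b : R → K a blocking key with blocks B_1, …, B_u listed in a fixed order, w ≥ 2 an integer, and f a local scoring heuristic (symmetric, nonnegative, and f(r, s) = 0 whenever b(r) ≠ b(s)). Then lists L_1, …, L_u (with L_i enumerating B_i) are such that the concatenation L_1 ⌢ ⋯ ⌢ L_u attains the maximum w-score among all concatenations M_1 ⌢ ⋯ ⌢ M_u with M_i an enumeration of B_i, if and only if each L_i attains the maximum w-score among all enumerations of B_i. That is, maximum-score w-ordering each block independently is both necessary and sufficient for maximum-score Sorted Neighborhood with a local scoring heuristic. -/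
theorem List.sum_get_append {α : Type*} (l₁ l₂ : List α) (g : ℕ → α → ℝ) :
    ∑ i : Fin (l₁ ++ l₂).length, g i ((l₁ ++ l₂).get i) =
      ∑ i : Fin l₁.length, g i (l₁.get i) +
        ∑ i : Fin l₂.length, g (l₁.length + i) (l₂.get i) := by
  induction l₁ generalizing g with
  | nil => simp
  | cons a l ih =>
    have h := ih fun i x => g (i + 1) x
    have hcons (m : List α) : ∑ i : Fin (a :: m).length, g i ((a :: m).get i) =
        g 0 a + ∑ i : Fin m.length, g (i + 1) (m.get i) := Fin.sum_univ_succ _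
    rw [hcons l, add_assoc]
    refine (hcons (l ++ l₂)).trans ?_
    rw [h]
    simp only [List.length_cons, add_right_comm]

theorem wScore_append {α : Type*} (f : α → α → ℝ) (w : ℕ) (l₁ l₂ : List α)
    (h : ∀ x ∈ l₁, ∀ y ∈ l₂, f x y = 0) :
    wScore f w (l₁ ++ l₂) = wScore f w l₁ + wScore f w l₂ := by
  unfold wScore
  rw [List.sum_get_append l₁ l₂ fun i x => ∑ j : Fin (l₁ ++ l₂).length,
    if i < (j : ℕ) ∧ (j : ℕ) - i ≤ w - 1 then f x ((l₁ ++ l₂).get j) else 0]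
  congr 1
  · refine Finset.sum_congr rfl fun i _ => ?_
    rw [List.sum_get_append l₁ l₂ fun j z =>
      if (i : ℕ) < j ∧ j - (i : ℕ) ≤ w - 1 then f (l₁.get i) z else 0]
    refine add_eq_left.2 (Finset.sum_eq_zero fun j _ => ?_)
    rw [h _ (l₁.get_mem i) _ (l₂.get_mem j), ite_self]
  · refine Finset.sum_congr rfl fun i _ => ?_
    rw [List.sum_get_append l₁ l₂ fun j z =>
      if l₁.length + (i : ℕ) < j ∧ j - (l₁.length + (i : ℕ)) ≤ w - 1 then f (l₂.get i) z else 0]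
    rw [Finset.sum_eq_zero fun j _ => if_neg fun hj => by have := j.isLt; omega, zero_add]
    refine Finset.sum_congr rfl fun j _ => ?_
    simp only [Nat.add_lt_add_iff_left, Nat.add_sub_add_left]

theorem wScore_flatten {α : Type*} (f : α → α → ℝ) (w : ℕ) (ls : List (List α))
    (h : ls.Pairwise fun l₁ l₂ => ∀ x ∈ l₁, ∀ y ∈ l₂, f x y = 0) :
    wScore f w ls.flatten = (ls.map (wScore f w)).sum := by
  induction ls with
  | nil => simp [wScore]
  | cons l ls ih =>
    rw [List.pairwise_cons] at h
    rw [List.flatten_cons, wScore_append, ih h.2, List.map_cons, List.sum_cons]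
    intro x hx z hz
    obtain ⟨m, hm, hzm⟩ := List.mem_flatten.1 hz
    exact h.1 m hm x hx z hzm

theorem wScore_flatten_ofFn_of_local {α K : Type*} (b : α → K) {u : ℕ} (y : Fin u → K)
    (hy : Function.Injective y) (w : ℕ) (f : α → α → ℝ)
    (hlocal : ∀ r s, b r ≠ b s → f r s = 0) (M : Fin u → List α)
    (hM : ∀ i, ∀ x ∈ M i, b x = y i) :
    wScore f w (List.ofFn M).flatten = ∑ i, wScore f w (M i) := by
  rw [wScore_flatten, List.map_ofFn, List.sum_ofFn]
  · rfl
  · rw [List.pairwise_ofFn]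
    intro i j hij x hx z hz
    refine hlocal x z ?_
    rw [hM i x hx, hM j z hz]
    exact hy.ne hij.ne

/-- For a local scoring heuristic `f`, the concatenation `L_1 ⌢ ⋯ ⌢ L_u`
(each `L_i` enumerating the block of key value `y i`) attains the maximum w-score among all
such concatenations if and only if each `L_i` attains the maximum w-score among all
enumerations of its block: maximum-score w-ordering each block independently is both
necessary and sufficient for maximum-score Sorted Neighborhood with a local heuristic. -/
theorem maxSN_iff_blockwise_max_of_local {α K : Type*} (R : Finset α) (b : α → K)
    (u : ℕ) (y : Fin u → K) (hy : Function.Injective y)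
    (w : ℕ) (hw : 2 ≤ w) (f : α → α → ℝ)
    (hsymm : ∀ r s, f r s = f s r) (hnonneg : ∀ r s, 0 ≤ f r s)
    (hlocal : ∀ r s, b r ≠ b s → f r s = 0)
    (L : Fin u → List α)
    (hnodup : ∀ i, (L i).Nodup)
    (henum : ∀ i x, x ∈ L i ↔ (x ∈ R ∧ b x = y i)) :
    (∀ M : Fin u → List α, (∀ i, (M i).Nodup) →
        (∀ i x, x ∈ M i ↔ (x ∈ R ∧ b x = y i)) →
        wScore f w (List.ofFn M).flatten ≤ wScore f w (List.ofFn L).flatten)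
      ↔ (∀ i, ∀ M : List α, M.Nodup → (∀ x, x ∈ M ↔ (x ∈ R ∧ b x = y i)) →
        wScore f w M ≤ wScore f w (L i)) := by
  have hsum (M : Fin u → List α) (hM : ∀ i x, x ∈ M i ↔ (x ∈ R ∧ b x = y i)) :=
    wScore_flatten_ofFn_of_local b y hy w f hlocal M fun i x hx => ((hM i x).1 hx).2
  constructor
  · intro h i N hN hNmem
    have hmem : ∀ j x, x ∈ Function.update L i N j ↔ (x ∈ R ∧ b x = y j) := by
      intro j
      obtain rfl | hj := eq_or_ne j i
      · simpa using hNmem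
      · simpa [hj] using henum j
    have hnd : ∀ j, (Function.update L i N j).Nodup := by
      intro j
      obtain rfl | hj := eq_or_ne j i
      · simpa using hN
      · simpa [hj] using hnodup j
    have hle := h _ hnd hmem
    rw [hsum _ hmem, hsum L henum, ← Finset.add_sum_erase _ _ (Finset.mem_univ i),
      ← Finset.add_sum_erase _ (fun j => wScore f w (L j)) (Finset.mem_univ i),
      Finset.sum_congr rfl fun j hj => by
        rw [Function.update_of_ne (Finset.ne_of_mem_erase hj)],
      Function.update_self] at hle
    exact le_of_add_le_add_right hle
  · intro h M hM hMmem
    rw [hsum M hMmem, hsum L henum]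
    exact Finset.sum_le_sum fun i _ => h i (M i) (hM i) (hMmem i)
end

section
/- Let m ≥ 2 and let W be a symmetric nonnegative-integer edge-weight function on the complete graph with vertex set {1, …, m} (no self-loops), and let W_E = Σ_{1 ≤ u < v ≤ m} W(u, v) be the total weight of all edges. Define f(u, v) = W_E − W(u, v) for u ≠ v (so f is symmetric and nonnegative). Then the maximum, over all permutations σ of {1, …, m}, of the 2-score Σ_{i=1}^{m−1} f(σ(i), σ(i+1)) equals (m − 1)·W_E minus the minimum, over all permutations σ, of the Hamiltonian-path weight Σ_{i=1}^{m−1} W(σ(i), σ(i+1)). In particular, for every integer k there exists an ordering with 2-score at least (m − 1)·W_E − k if and only if there exists a Hamiltonian path of weight at most k. -/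
/-- The 2-score (resp. Hamiltonian-path weight) of a list: the sum of `f` over
consecutive pairs of the list. -/
def chainSum {α β : Type*} [AddCommMonoid β] (f : α → α → β) (l : List α) : β :=
  (List.zipWith f l l.tail).sum

/-- If `f u v = c - g u v` off the diagonal, then along a nonempty list without repetitions the
two consecutive-pair sums add up to `c` times the number of consecutive pairs. -/
lemma chainSum_cons_eq_sub_of_nodup {α β : Type*} [CommRing β] {f g : α → α → β} {c : β}
    (h : ∀ u v, u ≠ v → f u v = c - g u v) (a : α) (l : List α) (hl : (a :: l).Nodup) :
    chainSum f (a :: l) = l.length * c - chainSum g (a :: l) := by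
  induction l generalizing a with
  | nil => simp [chainSum]
  | cons b l ih =>
    have hab : a ≠ b := by
      rintro rfl
      simp at hl
    have hcons (k : α → α → β) : chainSum k (a :: b :: l) = k a b + chainSum k (b :: l) := by
      simp [chainSum]
    rw [hcons f, hcons g, ih b hl.of_cons, h a b hab]
    push_cast [List.length_cons]
    ring

/-- For `m ≥ 2`, a symmetric nonnegative integer edge-weight function `W` on
the complete graph on `m` vertices with total edge weight `W_E`, and `f(u,v) = W_E − W(u,v)`
for `u ≠ v`, the maximum 2-score over all orderings (permutations) equals
`(m − 1)·W_E` minus the minimum Hamiltonian-path weight; in particular, for every integer `k`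
there is an ordering with 2-score at least `(m − 1)·W_E − k` iff there is a Hamiltonian path
of weight at most `k`. -/
theorem max_two_score_eq_of_min_path_TSP (m : ℕ) (hm : 2 ≤ m)
    (W : Fin m → Fin m → ℤ)
    (hWsymm : ∀ u v, W u v = W v u) (hWnonneg : ∀ u v, 0 ≤ W u v)
    (WE : ℤ)
    (hWE : WE = ∑ p ∈ Finset.univ.filter (fun p : Fin m × Fin m => p.1 < p.2), W p.1 p.2)
    (f : Fin m → Fin m → ℤ) (hf : ∀ u v, u ≠ v → f u v = WE - W u v) :
    (Finset.univ.sup' Finset.univ_nonempty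
        (fun σ : Equiv.Perm (Fin m) => chainSum f (List.ofFn ⇑σ))
      = ((m : ℤ) - 1) * WE -
        Finset.univ.inf' Finset.univ_nonempty
          (fun σ : Equiv.Perm (Fin m) => chainSum W (List.ofFn ⇑σ)))
    ∧ ∀ k : ℤ,
        (∃ σ : Equiv.Perm (Fin m), ((m : ℤ) - 1) * WE - k ≤ chainSum f (List.ofFn ⇑σ))
        ↔ (∃ σ : Equiv.Perm (Fin m), chainSum W (List.ofFn ⇑σ) ≤ k) := by
  have key (σ : Equiv.Perm (Fin m)) :
      chainSum f (List.ofFn σ) = ((m : ℤ) - 1) * WE - chainSum W (List.ofFn σ) := by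
    obtain ⟨n, rfl⟩ : ∃ n, m = n + 1 := ⟨m - 1, by omega⟩
    have hnodup : (List.ofFn σ).Nodup := List.nodup_ofFn.mpr σ.injective
    rw [List.ofFn_succ] at hnodup ⊢
    rw [chainSum_cons_eq_sub_of_nodup hf _ _ hnodup, List.length_ofFn]
    push_cast
    ring
  refine ⟨le_antisymm ?_ ?_, fun k => exists_congr fun σ => ?_⟩
  · refine Finset.sup'_le _ _ fun σ hσ => ?_
    rw [key]
    exact sub_le_sub_left (Finset.inf'_le (fun σ : Equiv.Perm (Fin m) => chainSum W (List.ofFn ⇑σ)) hσ) _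
  · obtain ⟨σ, hσ, hmin⟩ := Finset.exists_mem_eq_inf' Finset.univ_nonempty
      (fun σ : Equiv.Perm (Fin m) => chainSum W (List.ofFn ⇑σ))
    rw [hmin, ← key]
    exact Finset.le_sup' (fun σ : Equiv.Perm (Fin m) => chainSum f (List.ofFn ⇑σ)) hσ
  · rw [key, sub_le_sub_iff_left]
end

section
/- Let R be a finite set of records, b a blocking key with blocks B_1, …, B_u listed in a fixed order, and f a local scoring heuristic (symmetric, nonnegative, and f(r, s) = 0 whenever b(r) ≠ b(s)). Let 0 ≤ ρ ≤ 1 and suppose lists L_1, …, L_u are such that each L_i enumerates B_i and has 2-score at least ρ times the maximum 2-score over all enumerations of B_i. Then the concatenation L_1 ⌢ ⋯ ⌢ L_u has 2-score at least ρ·Φ*, where Φ* is the maximum 2-score over all Sorted-Neighborhood-valid orderings of R (concatenations M_1 ⌢ ⋯ ⌢ M_u with M_i an enumeration of B_i). That is, the approximation ratio of the Sorted Neighborhood algorithm that 2-orders each block with a ρ-approximate max tour-TSP subroutine is exactly the ratio ρ of the subroutine. -/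
theorem chainSum_nil {α β : Type*} [AddCommMonoid β] (f : α → α → β) :
    chainSum f [] = 0 := rfl

theorem chainSum_singleton {α β : Type*} [AddCommMonoid β] (f : α → α → β) (a : α) :
    chainSum f [a] = 0 := rfl

theorem chainSum_cons_cons {α β : Type*} [AddCommMonoid β] (f : α → α → β) (a b : α)
    (l : List α) : chainSum f (a :: b :: l) = f a b + chainSum f (b :: l) := by
  simp [chainSum]

theorem chainSum_append {α β : Type*} [AddCommMonoid β] (f : α → α → β) (l m : List α)
    (h : ∀ x ∈ l, ∀ z ∈ m, f x z = 0) :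
    chainSum f (l ++ m) = chainSum f l + chainSum f m := by
  induction l with
  | nil => simp [chainSum_nil]
  | cons a l ih =>
    cases l with
    | nil =>
      cases m with
      | nil => simp [chainSum_nil, chainSum_singleton]
      | cons c m => simp [chainSum_cons_cons, chainSum_singleton, h a (by simp) c (by simp)]
    | cons c l =>
      have ih' := ih fun x hx => h x (List.mem_cons_of_mem _ hx)
      rw [List.cons_append] at ih'
      rw [List.cons_append, List.cons_append, chainSum_cons_cons, chainSum_cons_cons, ih',
        add_assoc]

theorem chainSum_flatten {α β : Type*} [AddCommMonoid β] (f : α → α → β) (Ls : List (List α))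
    (h : Ls.Pairwise fun l m => ∀ x ∈ l, ∀ z ∈ m, f x z = 0) :
    chainSum f Ls.flatten = (Ls.map (chainSum f)).sum := by
  induction Ls with
  | nil => simp [chainSum_nil]
  | cons l Ls ih =>
    rw [List.pairwise_cons] at h
    rw [List.flatten_cons, chainSum_append, ih h.2, List.map_cons, List.sum_cons]
    intro x hx z hz
    obtain ⟨m, hm, hzm⟩ := List.mem_flatten.1 hz
    exact h.1 m hm x hx z hzm

theorem chainSum_flatten_ofFn {α β : Type*} [AddCommMonoid β] (f : α → α → β) {u : ℕ}
    (M : Fin u → List α) (h : ∀ i j, i < j → ∀ x ∈ M i, ∀ z ∈ M j, f x z = 0) :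
    chainSum f (List.ofFn M).flatten = ∑ i, chainSum f (M i) := by
  rw [chainSum_flatten f _ (List.pairwise_ofFn.2 fun i j hij => h i j hij), List.map_ofFn,
    List.sum_ofFn]
  rfl


/-- Let `f` be a local scoring heuristic for blocking key `b` with blocks
the fibers of the key values `y i`, and let `0 ≤ ρ ≤ 1`. If each list `L_i` enumerates its
block and has 2-score at least `ρ` times the maximum 2-score `Φ i` over all enumerations of
that block, then the concatenation `L_1 ⌢ ⋯ ⌢ L_u` has 2-score at least `ρ·Φ*`, where `Φ*`
is the maximum 2-score over all Sorted-Neighborhood-valid orderings of `R` (concatenations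
of enumerations of the blocks in their fixed order). -/
theorem approx_ratio_sorted_neighborhood {α K : Type*} (R : Finset α) (b : α → K)
    (u : ℕ) (y : Fin u → K) (hy : Function.Injective y)
    (f : α → α → ℝ)
    (hsymm : ∀ r s, f r s = f s r) (hnonneg : ∀ r s, 0 ≤ f r s)
    (hlocal : ∀ r s, b r ≠ b s → f r s = 0)
    (ρ : ℝ) (hρ0 : 0 ≤ ρ) (hρ1 : ρ ≤ 1)
    (L : Fin u → List α)
    (hnodup : ∀ i, (L i).Nodup)
    (henum : ∀ i x, x ∈ L i ↔ (x ∈ R ∧ b x = y i))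
    (Φ : Fin u → ℝ)
    (hΦ : ∀ i, IsGreatest
      {x : ℝ | ∃ M : List α, M.Nodup ∧ (∀ z, z ∈ M ↔ (z ∈ R ∧ b z = y i)) ∧
        x = chainSum f M} (Φ i))
    (hL : ∀ i, ρ * Φ i ≤ chainSum f (L i))
    (Φstar : ℝ)
    (hstar : IsGreatest
      {x : ℝ | ∃ M : Fin u → List α, (∀ i, (M i).Nodup) ∧
        (∀ i z, z ∈ M i ↔ (z ∈ R ∧ b z = y i)) ∧
        x = chainSum f (List.ofFn M).flatten} Φstar) :
    ρ * Φstar ≤ chainSum f (List.ofFn L).flatten := by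
  have hsum : ∀ M : Fin u → List α, (∀ i z, z ∈ M i ↔ (z ∈ R ∧ b z = y i)) →
      chainSum f (List.ofFn M).flatten = ∑ i, chainSum f (M i) := by
    refine fun M hM => chainSum_flatten_ofFn f M fun i j hij x hx z hz => hlocal x z ?_
    rw [((hM i x).1 hx).2, ((hM j z).1 hz).2]
    exact hy.ne hij.ne
  obtain ⟨⟨M, hMnodup, hM, rfl⟩, -⟩ := hstar
  rw [hsum M hM, hsum L henum, Finset.mul_sum]
  refine Finset.sum_le_sum fun i _ => le_trans ?_ (hL i)
  exact mul_le_mul_of_nonneg_left ((hΦ i).2 ⟨M i, hMnodup i, hM i, rfl⟩) hρ0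
end

section
/- There exist two disjoint finite sets of records B_1 and B_2, a symmetric nonnegative scoring function f (which is global: some pairs with one record in B_1 and one in B_2 have nonzero score), and lists L_1, L_2 such that each L_i is a maximum-2-score enumeration of B_i, yet the 2-score of the concatenation L_1 ⌢ L_2 is strictly smaller than the maximum 2-score over all concatenations M_1 ⌢ M_2 with M_i an enumeration of B_i. That is, for a global scoring heuristic, maximum-score 2-ordering each block independently is not sufficient for maximum-score Sorted Neighborhood. -/
/-- There exist two disjoint finite blocks `B_1, B_2`, a symmetric
nonnegative scoring function `f` which is global (some pair straddling the two blocks has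
nonzero score), and lists `L_1, L_2` that are maximum-2-score enumerations of `B_1, B_2`
respectively, yet the 2-score of `L_1 ⌢ L_2` is strictly smaller than that of some other
concatenation `M_1 ⌢ M_2` of enumerations of the blocks: for a global scoring heuristic,
maximum-score 2-ordering each block independently is not sufficient for maximum-score
Sorted Neighborhood. -/
theorem global_blockwise_max_not_sufficient :
    ∃ (B₁ B₂ : Finset ℕ) (f : ℕ → ℕ → ℝ) (L₁ L₂ M₁ M₂ : List ℕ),
      Disjoint B₁ B₂ ∧
      (∀ r s, f r s = f s r) ∧ (∀ r s, 0 ≤ f r s) ∧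
      (∃ r ∈ B₁, ∃ s ∈ B₂, f r s ≠ 0) ∧
      L₁.Nodup ∧ (∀ x, x ∈ L₁ ↔ x ∈ B₁) ∧
      L₂.Nodup ∧ (∀ x, x ∈ L₂ ↔ x ∈ B₂) ∧
      (∀ M : List ℕ, M.Nodup → (∀ x, x ∈ M ↔ x ∈ B₁) → chainSum f M ≤ chainSum f L₁) ∧
      (∀ M : List ℕ, M.Nodup → (∀ x, x ∈ M ↔ x ∈ B₂) → chainSum f M ≤ chainSum f L₂) ∧
      M₁.Nodup ∧ (∀ x, x ∈ M₁ ↔ x ∈ B₁) ∧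
      M₂.Nodup ∧ (∀ x, x ∈ M₂ ↔ x ∈ B₂) ∧
      chainSum f (L₁ ++ L₂) < chainSum f (M₁ ++ M₂) := by
  refine ⟨{0, 1}, {2}, fun r s => if r + s = 3 then 0 else 1, [0, 1], [2], [1, 0], [2],
    by simp, fun r s => by simp only [add_comm], fun r s => by positivity,
    ⟨0, by simp, 2, by simp, by norm_num⟩, by simp, by simp, by simp, by simp, ?_, ?_,
    by simp, by simp [or_comm], by simp, by simp, by norm_num [chainSum]⟩
  · intro M hM hmem
    have hperm : M.Perm [0, 1] :=
      (List.perm_ext_iff_of_nodup hM (by simp)).2 fun x => by simp [hmem]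
    have hM' : M = [0, 1] ∨ M = [1, 0] := by
      simpa [List.permutations, List.permutationsAux_cons, List.permutationsAux_nil,
        List.permutationsAux2] using List.mem_permutations.2 hperm
    rcases hM' with rfl | rfl <;> norm_num [chainSum]
  · intro M hM hmem
    have hperm : M.Perm [2] :=
      (List.perm_ext_iff_of_nodup hM (by simp)).2 fun x => by simp [hmem]
    rw [List.perm_singleton.1 hperm]
end

section
/- There exist two disjoint finite sets of records B_1 and B_2, a symmetric nonnegative scoring function f (global, i.e., with nonzero scores for some pairs straddling the two blocks), and lists M_1, M_2 with M_i an enumeration of B_i such that M_2 is not a maximum-2-score enumeration of B_2, yet the 2-score of M_1 ⌢ M_2 is at least the 2-score of L_1 ⌢ L_2 for every pair of enumerations L_1 of B_1 and L_2 of B_2. That is, for a global scoring heuristic, maximum-score 2-ordering each block is not necessary for maximum-score Sorted Neighborhood. -/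
/-- A symmetric score on `{0, 1, 2, 3}`: record `2` scores `1` with each of `1` and `3`, and `5`
with `0`; all other pairs score `0`. -/
def hubScore (r s : ℕ) : ℝ :=
  if (r = 0 ∧ s = 2) ∨ (r = 2 ∧ s = 0) then 5
  else if (r = 2 ∧ (s = 1 ∨ s = 3)) ∨ (s = 2 ∧ (r = 1 ∨ r = 3)) then 1
  else 0

theorem hubScore_comm (r s : ℕ) : hubScore r s = hubScore s r := by
  unfold hubScore
  congr 1
  · grind
  · congr 1
    grind

theorem hubScore_nonneg (r s : ℕ) : 0 ≤ hubScore r s := by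
  unfold hubScore
  split_ifs <;> norm_num

/-- There exist two disjoint finite blocks `B_1, B_2`, a symmetric
nonnegative scoring function `f` which is global (some pair straddling the two blocks has
nonzero score), and enumerations `M_1` of `B_1` and `M_2` of `B_2` such that `M_2` is not a
maximum-2-score enumeration of `B_2`, yet `M_1 ⌢ M_2` has 2-score at least that of every
concatenation `L_1 ⌢ L_2` of enumerations of the blocks: for a global scoring heuristic,
maximum-score 2-ordering each block is not necessary for maximum-score Sorted
Neighborhood. -/
theorem global_blockwise_max_not_necessary :
    ∃ (B₁ B₂ : Finset ℕ) (f : ℕ → ℕ → ℝ) (M₁ M₂ : List ℕ),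
      Disjoint B₁ B₂ ∧
      (∀ r s, f r s = f s r) ∧ (∀ r s, 0 ≤ f r s) ∧
      (∃ r ∈ B₁, ∃ s ∈ B₂, f r s ≠ 0) ∧
      M₁.Nodup ∧ (∀ x, x ∈ M₁ ↔ x ∈ B₁) ∧
      M₂.Nodup ∧ (∀ x, x ∈ M₂ ↔ x ∈ B₂) ∧
      (∃ M' : List ℕ, M'.Nodup ∧ (∀ x, x ∈ M' ↔ x ∈ B₂) ∧
        chainSum f M₂ < chainSum f M') ∧
      (∀ L₁ L₂ : List ℕ, L₁.Nodup → (∀ x, x ∈ L₁ ↔ x ∈ B₁) →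
        L₂.Nodup → (∀ x, x ∈ L₂ ↔ x ∈ B₂) →
        chainSum f (L₁ ++ L₂) ≤ chainSum f (M₁ ++ M₂)) := by
  refine ⟨{0}, {1, 2, 3}, hubScore, [0], [2, 1, 3], by decide, hubScore_comm, hubScore_nonneg,
    ⟨0, by simp, 2, by simp, by norm_num [hubScore]⟩, by simp, by simp, by simp,
    fun x ↦ by simp; tauto,
    ⟨[1, 2, 3], by simp, fun x ↦ by simp, by norm_num [chainSum, hubScore]⟩, ?_⟩
  intro L₁ L₂ h₁ m₁ h₂ m₂
  have p₁ : L₁.Perm [0] :=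
    (List.perm_ext_iff_of_nodup h₁ (by simp)).2 fun x ↦ by simp [m₁]
  have p₂ : L₂.Perm [1, 2, 3] :=
    (List.perm_ext_iff_of_nodup h₂ (by simp)).2 fun x ↦ by simp [m₂]
  rw [List.perm_singleton] at p₁
  rw [← List.mem_permutations'] at p₂
  simp [List.permutations'] at p₂
  subst p₁
  rcases p₂ with rfl | rfl | rfl | rfl | rfl | rfl <;> norm_num [chainSum, hubScore]
end

section
/- There exist a finite set R of records, two blocks B_1, B_2 ⊆ R with B_1 ∩ B_2 ≠ ∅ (as produced by a many-many, i.e., non-functional, blocking key), and a symmetric nonnegative scoring function f, such that every choice of lists K_1, K_2 in which each K_i is a maximum-2-score enumeration of B_i yields a block-merge candidate set (the union of the sets of consecutive pairs of K_1 and of K_2, with each distinct unordered pair counted once) whose total score Σ_{{r,s} ∈ Γ} f(r, s) is strictly smaller than the candidate-set score obtained from some other choice of enumerations of B_1 and B_2. That is, maximum-score 2-ordering each block individually does not guarantee a maximum-score candidate set for many-many traditional blocking. -/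
/-- The set of unordered pairs of consecutive elements of a list (each distinct unordered
pair counted once): the candidate set contributed by one block under the block-merge
procedure with window size `w = 2`. -/
def consecPairs (l : List ℕ) : Finset (Sym2 ℕ) :=
  (List.zipWith (fun a b => s(a, b)) l l.tail).toFinset

/-- The score giving the pair `{0, 1}` weight `2` and every other pair weight `1`. -/
def heavyPairScore (p : Sym2 ℕ) : ℝ := if p = s(0, 1) then 2 else 1

/-- A maximum-2-score enumeration of `{0, 1, c}` under `heavyPairScore` makes `0` and `1`
consecutive, so its other consecutive pair joins `c` to `0` or to `1`. -/
theorem consecPairs_of_max_heavyPairScore {c : ℕ} (h0 : c ≠ 0) (h1 : c ≠ 1) {K : List ℕ}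
    (hK : K.Nodup) (hmem : ∀ x, x ∈ K ↔ x ∈ ({0, 1, c} : Finset ℕ))
    (hmax : ∀ M : List ℕ, M.Nodup → (∀ x, x ∈ M ↔ x ∈ ({0, 1, c} : Finset ℕ)) →
      chainSum (fun a b => heavyPairScore s(a, b)) M ≤
        chainSum (fun a b => heavyPairScore s(a, b)) K) :
    consecPairs K = {s(0, 1), s(0, c)} ∨ consecPairs K = {s(0, 1), s(1, c)} := by
  have hperm : K.Perm [0, 1, c] :=
    (List.perm_ext_iff_of_nodup hK (by simp [h0.symm, h1.symm])).2 (by simpa using hmem)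
  have hle := hmax [0, 1, c] (by simp [h0.symm, h1.symm]) (by simp)
  have hcases : K ∈ [0, 1, c].permutations := List.mem_permutations.2 hperm
  simp only [List.permutations, List.permutationsAux, List.permutationsAux.rec,
    List.permutationsAux2, List.foldr, List.mem_cons, List.not_mem_nil, or_false, id] at hcases
  rcases hcases with rfl | rfl | rfl | rfl | rfl | rfl <;>
    simp [chainSum, heavyPairScore, h0, h1] at hle <;>
    simp [consecPairs, Sym2.eq_swap, Finset.pair_comm]

/-- There exist a finite set `R` of records, two overlapping blocks
`B_1, B_2 ⊆ R` (as produced by a many-many blocking key), and a symmetric nonnegative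
scoring function (given as `g` on unordered pairs; the corresponding symmetric function is
`f a b = g s(a,b)`), such that every choice of maximum-2-score enumerations `K_1` of `B_1`
and `K_2` of `B_2` yields a block-merge candidate set `Γ = consecPairs K₁ ∪ consecPairs K₂`
whose total score `Σ_{p ∈ Γ} g p` is strictly smaller than the candidate-set score from
some other choice of enumerations of `B_1` and `B_2`. -/
theorem manyMany_blockwise_max_not_sufficient :
    ∃ (R B₁ B₂ : Finset ℕ) (g : Sym2 ℕ → ℝ),
      B₁ ⊆ R ∧ B₂ ⊆ R ∧ (B₁ ∩ B₂).Nonempty ∧ (∀ p, 0 ≤ g p) ∧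
      ∀ K₁ K₂ : List ℕ,
        K₁.Nodup → (∀ x, x ∈ K₁ ↔ x ∈ B₁) →
        K₂.Nodup → (∀ x, x ∈ K₂ ↔ x ∈ B₂) →
        (∀ M : List ℕ, M.Nodup → (∀ x, x ∈ M ↔ x ∈ B₁) →
          chainSum (fun a b => g s(a, b)) M ≤ chainSum (fun a b => g s(a, b)) K₁) →
        (∀ M : List ℕ, M.Nodup → (∀ x, x ∈ M ↔ x ∈ B₂) →
          chainSum (fun a b => g s(a, b)) M ≤ chainSum (fun a b => g s(a, b)) K₂) →
        ∃ K₁' K₂' : List ℕ,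
          K₁'.Nodup ∧ (∀ x, x ∈ K₁' ↔ x ∈ B₁) ∧
          K₂'.Nodup ∧ (∀ x, x ∈ K₂' ↔ x ∈ B₂) ∧
          ∑ p ∈ consecPairs K₁ ∪ consecPairs K₂, g p
            < ∑ p ∈ consecPairs K₁' ∪ consecPairs K₂', g p := by
  refine ⟨{0, 1, 2, 3}, {0, 1, 2}, {0, 1, 3}, heavyPairScore, by decide, by decide,
    by decide, fun p => by unfold heavyPairScore; split_ifs <;> norm_num, ?_⟩
  intro K₁ K₂ hK₁ hmem₁ hK₂ hmem₂ hmax₁ hmax₂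
  refine ⟨[0, 1, 2], [0, 3, 1], by decide, by simp, by decide, by simp; tauto, ?_⟩
  have hΓ' : consecPairs [0, 1, 2] ∪ consecPairs [0, 3, 1] =
      {s(0, 1), s(1, 2), s(0, 3), s(3, 1)} := by decide
  have hsum : ∑ p ∈ ({s(0, 1), s(1, 2), s(0, 3), s(3, 1)} : Finset (Sym2 ℕ)),
      heavyPairScore p = 5 := by
    simp [heavyPairScore, Finset.sum_insert]; norm_num
  rw [hΓ', hsum]
  rcases consecPairs_of_max_heavyPairScore (by decide) (by decide) hK₁ hmem₁ hmax₁ with h | h <;>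
    rcases consecPairs_of_max_heavyPairScore (by decide) (by decide) hK₂ hmem₂ hmax₂
      with h' | h' <;>
    rw [h, h'] <;> simp [heavyPairScore, Finset.sum_insert] <;> norm_num
end
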